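/- arXiv:1909.00838 — 4 statements merged into one kernel-verified Lean document; each statement's English description precedes it below -/
import Mathlib

section
/- Let X be a real 2n×2n matrix with det X ≠ 0. Then there exists a Hamiltonian matrix H (i.e. (J·H)ᵀ = J·H) and a real anti-symplectic matrix T (i.e. T·J·Tᵀ = -J) such that X = H·T. -/
open Matrix

/-- The standard symplectic form matrix `J = [[0, -I_n], [I_n, 0]]`. -/
def symplJ (n : ℕ) : Matrix (Fin n ⊕ Fin n) (Fin n ⊕ Fin n) ℝ :=
  Matrix.fromBlocks 0 (-1) 1 0

/-- The block diagonal matrix `D = [[I_n, 0], [0, -I_n]]`. -/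
def Dmat (n : ℕ) : Matrix (Fin n ⊕ Fin n) (Fin n ⊕ Fin n) ℝ :=
  Matrix.fromBlocks 1 0 0 (-1)

/-- A linear map that vanishes on the kernel of `g` factors through `g`. -/
theorem LinearMap.exists_comp_eq_of_ker_le {K M V V' : Type*} [Field K]
    [AddCommGroup M] [Module K M] [AddCommGroup V] [Module K V] [AddCommGroup V'] [Module K V']
    (g : M →ₗ[K] V) (h : M →ₗ[K] V') (hgh : LinearMap.ker g ≤ LinearMap.ker h) :
    ∃ f : V →ₗ[K] V', ∀ m, f (g m) = h m := by
  obtain ⟨f, hf⟩ := LinearMap.exists_extend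
    ((LinearMap.ker g).liftQ h hgh ∘ₗ (g.quotKerEquivRange).symm.toLinearMap)
  refine ⟨f, fun m => ?_⟩
  have h1 := LinearMap.congr_fun hf ⟨g m, m, rfl⟩
  have h2 : g.quotKerEquivRange.symm ⟨g m, m, rfl⟩ = (LinearMap.ker g).mkQ m := by
    rw [LinearEquiv.symm_apply_eq]
    rfl
  simpa [h2] using h1

namespace Module.End

variable {K V : Type*} [Field K] [AddCommGroup V] [Module K V]

open Polynomial

/-- The map sending a polynomial `p` to `p(W) x`. -/
noncomputable def orbitMap (W : Module.End K V) (x : V) : K[X] →ₗ[K] V :=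
  LinearMap.applyₗ x ∘ₗ (aeval W).toLinearMap

@[simp]
theorem orbitMap_apply (W : Module.End K V) (x : V) (p : K[X]) :
    orbitMap W x p = aeval W p x := rfl

/-- Some vector is annihilated only by the multiples of the minimal polynomial. -/
theorem exists_forall_aeval_apply_eq_zero [FiniteDimensional K V] (W : Module.End K V) :
    ∃ x : V, ∀ p : K[X], aeval W p x = 0 → aeval W p = 0 := by
  obtain ⟨x, hx⟩ := Module.exists_ker_toSpanSingleton_eq_annihilator
    (R := K[X]) (M := Module.AEval' W)
  refine ⟨(Module.AEval'.of W).symm x, fun p hp => ?_⟩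
  have h1 : p ∈ LinearMap.ker (LinearMap.toSpanSingleton K[X] (Module.AEval' W) x) := by
    rw [LinearMap.mem_ker, LinearMap.toSpanSingleton_apply,
      ← (Module.AEval'.of W).symm.map_eq_zero_iff, Module.AEval.of_symm_smul]
    exact hp
  rw [hx, Module.AEval.annihilator_eq_ker_aeval] at h1
  exact h1

/-- A linear functional whose kernel contains no nonzero submodule of the cyclic module
generated by a vector of maximal order. -/
theorem exists_dual_separating_orbit [FiniteDimensional K V] (W : Module.End K V) (x : V)
    (hx : ∀ p : K[X], aeval W p x = 0 → aeval W p = 0) :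
    ∃ f : Module.Dual K V, ∀ p : K[X], (∀ r : K[X], f (aeval W (p * r) x) = 0) →
      aeval W p x = 0 := by
  set m := minpoly K W
  have hm : m.Monic := minpoly.monic (Algebra.IsIntegral.isIntegral W)
  have hmW : aeval W m = 0 := minpoly.aeval K W
  have hmod (p : K[X]) : aeval W (p %ₘ m) = aeval W p := by
    conv_rhs => rw [← modByMonic_add_div p m]
    simp [hmW]
  obtain ⟨f, hf⟩ := LinearMap.exists_comp_eq_of_ker_le (orbitMap W x)
    (lcoeff K (m.natDegree - 1) ∘ₗ modByMonicHom m) (by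
      intro p hp
      have : m ∣ p := minpoly.dvd K W (hx p hp)
      rw [← modByMonic_eq_zero_iff_dvd hm] at this
      simp [this])
  refine ⟨f, fun p hp => ?_⟩
  by_contra hne
  set s := p %ₘ m with hs
  have hs0 : s ≠ 0 := by
    intro h0
    apply hne
    rw [← hmod, ← hs, h0]
    simp
  have hm1 : m ≠ 1 := by
    intro h1
    apply hs0
    rw [hs, h1, modByMonic_one]
  have hlt : s.natDegree < m.natDegree := natDegree_modByMonic_lt p hm hm1
  have h1 := hp (X ^ (m.natDegree - 1 - s.natDegree))
  have h2 : aeval W (p * X ^ (m.natDegree - 1 - s.natDegree)) x =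
      orbitMap W x (s * X ^ (m.natDegree - 1 - s.natDegree)) := by
    simp [hs, hmod]
  rw [h2, hf] at h1
  have hdeg : (s * X ^ (m.natDegree - 1 - s.natDegree)).natDegree < m.natDegree := by
    rw [natDegree_mul_X_pow _ hs0]
    omega
  have hself : (s * X ^ (m.natDegree - 1 - s.natDegree)) %ₘ m =
      s * X ^ (m.natDegree - 1 - s.natDegree) :=
    (modByMonic_eq_self_iff hm).2 (degree_lt_degree hdeg)
  simp only [LinearMap.comp_apply, modByMonicHom_apply, lcoeff_apply, hself] at h1
  rw [show m.natDegree - 1 = s.natDegree + (m.natDegree - 1 - s.natDegree) by omega,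
    add_tsub_cancel_left, coeff_mul_X_pow] at h1
  exact hs0 (leadingCoeff_eq_zero.1 h1)

end Module.End

namespace LinearMap.BilinForm

open LinearMap (BilinForm)

variable {K V : Type*} [Field K] [AddCommGroup V] [Module K V]

open Polynomial Module.End

theorem aeval_selfAdjoint {B : BilinForm K V} {W : Module.End K V}
    (hW : ∀ u v, B (W u) v = B u (W v)) (p : K[X]) (u v : V) :
    B (aeval W p u) v = B u (aeval W p v) := by
  induction p using Polynomial.induction_on' generalizing u v with
  | add p q hp hq => simp [hp, hq]
  | monomial n a =>
    have hpow : ∀ u v, B ((W ^ n) u) v = B u ((W ^ n) v) := by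
      induction n with
      | zero => simp
      | succ n ih =>
        intro u v
        rw [pow_succ, Module.End.mul_apply, ih, hW, ← Module.End.mul_apply, ← pow_succ', pow_succ]
    simp [aeval_monomial, hpow]

/-- A nonzero space with a nondegenerate alternating form contains a nonzero nondegenerate
subspace, invariant under a given self-adjoint endomorphism `W`, on which `W` has a
skew-adjoint square root. -/
theorem exists_subspace_skewAdjoint_sqrt [NeZero (2 : K)] [FiniteDimensional K V] [Nontrivial V]
    {B : BilinForm K V} (hB : B.IsAlt) (hnd : B.Nondegenerate) {W : Module.End K V}
    (hW : ∀ u v, B (W u) v = B u (W v)) :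
    ∃ (U : Submodule K V) (H : Module.End K V), U ≠ ⊥ ∧ Disjoint U (B.orthogonal U) ∧
      (∀ u ∈ U, W u ∈ U) ∧ (∀ u ∈ U, H u ∈ U) ∧ (∀ u ∈ U, H (H u) = W u) ∧
      ∀ u ∈ U, ∀ v ∈ U, B (H u) v = -B u (H v) := by
  obtain ⟨x, hx⟩ := exists_forall_aeval_apply_eq_zero W
  obtain ⟨f, hf⟩ := exists_dual_separating_orbit W x hx
  set y := -(B.toDual hnd).symm f
  have hadj := aeval_selfAdjoint hW
  have hneg (u v : V) : B u v = -B v u := (hB.neg_eq v u).symm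
  have hfy (v : V) : f v = B v y := by
    have : B ((B.toDual hnd).symm f) v = f v := apply_toDual_symm_apply ..
    rw [hneg, map_neg, LinearMap.neg_apply, this, neg_neg]
  have hiso (z : V) (p q : K[X]) : B (aeval W p z) (aeval W q z) = 0 := by
    rw [← hadj, ← Module.End.mul_apply, ← map_mul]
    have h1 : B (aeval W (q * p) z) z = -B (aeval W (q * p) z) z := by
      conv_lhs => rw [hadj, hneg]
    have h2 : (2 : K) * B (aeval W (q * p) z) z = 0 := by linear_combination h1
    exact (mul_eq_zero.1 h2).resolve_left two_ne_zero
  have hsep (p : K[X]) (h : ∀ r : K[X], B (aeval W (p * r) x) y = 0) : aeval W p = 0 :=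
    hx p (hf p (fun r => by rw [hfy, h]))
  have hxy (p q : K[X]) : B (aeval W p x) (aeval W q y) = B (aeval W (p * q) x) y := by
    rw [← hadj, ← Module.End.mul_apply, ← map_mul, mul_comm]
  set φ := (orbitMap W x).coprod (orbitMap W y)
  have hφ (p q : K[X]) : φ (p, q) = aeval W p x + aeval W q y := by simp [φ]
  have hform (p q r s : K[X]) :
      B (φ (p, q)) (φ (r, s)) = B (aeval W (p * s) x) y - B (aeval W (q * r) x) y := by
    rw [hφ, hφ, map_add, map_add, LinearMap.add_apply, LinearMap.add_apply, hiso, hiso, hxy,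
      hneg (aeval W q y), hxy, mul_comm r q]
    ring
  have hrad (p q : K[X]) (h : ∀ r s, B (φ (r, s)) (φ (p, q)) = 0) :
      aeval W p = 0 ∧ aeval W q = 0 := by
    refine ⟨hsep p fun r => ?_, hsep q fun r => ?_⟩
    · have := h 0 r
      rw [hform] at this
      simpa [mul_comm] using this
    · have := h r 0
      rw [hform] at this
      simpa [mul_comm] using this
  obtain ⟨H, hH⟩ := LinearMap.exists_comp_eq_of_ker_le φ
    ((orbitMap W y).coprod (orbitMap W (W x))) (by
      rintro ⟨p, q⟩ hpq
      obtain ⟨hp, hq⟩ := hrad p q fun r s => by rw [LinearMap.mem_ker.1 hpq, map_zero]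
      simp [hp, hq])
  have hH' (p q : K[X]) : H (φ (p, q)) = φ (q * X, p) := by
    rw [hH, hφ]
    simp [add_comm]
  have hWφ (p q : K[X]) : W (φ (p, q)) = φ (X * p, X * q) := by
    rw [hφ, hφ]
    simp
  refine ⟨LinearMap.range φ, H, ?_, ?_, ?_, ?_, ?_, ?_⟩
  · intro h
    have h1 : φ (1, 0) = 0 := by
      rw [← Submodule.mem_bot K, ← h]
      exact ⟨_, rfl⟩
    have h2 := hx 1 (by simpa [hφ] using h1)
    simp at h2
  · rw [Submodule.disjoint_def]
    rintro _ ⟨⟨p, q⟩, rfl⟩ h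
    obtain ⟨hp, hq⟩ := hrad p q fun r s => h _ ⟨(r, s), rfl⟩
    simp [hφ, hp, hq]
  · rintro _ ⟨⟨p, q⟩, rfl⟩
    exact ⟨_, (hWφ p q).symm⟩
  · rintro _ ⟨⟨p, q⟩, rfl⟩
    exact ⟨_, (hH' p q).symm⟩
  · rintro _ ⟨⟨p, q⟩, rfl⟩
    rw [hH', hH', hWφ, mul_comm, mul_comm q]
  · rintro _ ⟨⟨p, q⟩, rfl⟩ _ ⟨⟨r, s⟩, rfl⟩
    rw [hH', hH', hform, hform, show q * X * s = q * (s * X) by ring]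
    ring

/-- An endomorphism that is self-adjoint for a nondegenerate alternating form has a skew-adjoint
square root. -/
theorem exists_skewAdjoint_sqrt [NeZero (2 : K)] [FiniteDimensional K V]
    {B : BilinForm K V} (hB : B.IsAlt) (hnd : B.Nondegenerate) {W : Module.End K V}
    (hW : ∀ u v, B (W u) v = B u (W v)) :
    ∃ H : Module.End K V, (∀ v, H (H v) = W v) ∧ ∀ u v, B (H u) v = -B u (H v) := by
  induction hn : Module.finrank K V using Nat.strong_induction_on generalizing V with
  | _ n ih =>
  rcases subsingleton_or_nontrivial V with hV | hV
  · exact ⟨0, fun v => Subsingleton.elim _ _, fun u v => by simp [Subsingleton.elim v 0]⟩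
  obtain ⟨U, H, hU, hdisj, hWU, hHU, hHH, hskew⟩ := exists_subspace_skewAdjoint_sqrt hB hnd hW
  set U' := B.orthogonal U with hU'
  have hc : IsCompl U U' := (isCompl_orthogonal_iff_disjoint hB.isRefl).2 hdisj
  have hWU' : ∀ w ∈ U', W w ∈ U' := by
    intro w hw u hu
    change B u (W w) = 0
    rw [← hW]
    exact hw _ (hWU u hu)
  have hnd' : (B.restrict U').Nondegenerate := by
    apply nondegenerate_restrict_of_disjoint_orthogonal B hB.isRefl
    rw [hU', orthogonal_orthogonal hnd hB.isRefl]
    exact hdisj.symm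
  have hlt : Module.finrank K U' < n := by
    rw [← hn]
    apply Submodule.finrank_lt
    intro htop
    apply hU
    simpa [htop] using hdisj
  obtain ⟨G, hGG, hG⟩ := ih _ hlt (V := U') (B := B.restrict U') (fun u => hB u) hnd'
    (W := W.restrict hWU') (fun u v => hW u v) rfl
  set F : Module.End K V := LinearMap.ofIsCompl hc (H ∘ₗ U.subtype) (U'.subtype ∘ₗ G)
  have hF₁ : ∀ u ∈ U, F u = H u := fun u hu => LinearMap.ofIsCompl_apply_left hc ⟨u, hu⟩
  have hF₂ (w : U') : F w = G w := LinearMap.ofIsCompl_apply_right hc w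
  have hdec (v : V) : ∃ u ∈ U, ∃ w : U', u + w = v := by
    obtain ⟨u, hu, w, hw, h⟩ := Submodule.mem_sup.1 (hc.sup_eq_top ▸ Submodule.mem_top (x := v))
    exact ⟨u, hu, ⟨w, hw⟩, h⟩
  have horth : ∀ u ∈ U, ∀ w : U', B u w = 0 := fun u hu w => w.2 u hu
  have horth' : ∀ u ∈ U, ∀ w : U', B w u = 0 := fun u hu w => hB.isRefl _ _ (horth u hu w)
  refine ⟨F, fun v => ?_, fun v v' => ?_⟩
  · obtain ⟨u, hu, w, rfl⟩ := hdec v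
    have h := congrArg Subtype.val (hGG w)
    rw [map_add, map_add, hF₁ u hu, hF₁ _ (hHU u hu), hF₂, hF₂, hHH u hu, h, map_add]
    rfl
  · obtain ⟨u, hu, w, rfl⟩ := hdec v
    obtain ⟨u', hu', w', rfl⟩ := hdec v'
    have h : B (G w) w' = -B w (G w') := hG w w'
    simp only [map_add, LinearMap.add_apply, hF₁ u hu, hF₁ u' hu', hF₂, horth _ (hHU u hu),
      horth' _ hu', horth _ hu, horth' _ (hHU u' hu'), hskew u hu u' hu', h]
    ring

end LinearMap.BilinForm

theorem symplJ_transpose (n : ℕ) : (symplJ n)ᵀ = -symplJ n := by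
  simp [symplJ, fromBlocks_transpose, fromBlocks_neg]

theorem symplJ_mul_self (n : ℕ) : symplJ n * symplJ n = -1 := by
  rw [← fromBlocks_one, fromBlocks_neg]
  simp [symplJ, fromBlocks_multiply]

theorem isUnit_det_symplJ (n : ℕ) : IsUnit (symplJ n).det := by
  rw [← isUnit_iff_isUnit_det]
  exact IsUnit.of_mul_eq_one (-symplJ n) (by rw [mul_neg, symplJ_mul_self, neg_neg])

theorem isAlt_toBilin'_symplJ (n : ℕ) : (Matrix.toBilin' (symplJ n)).IsAlt := by
  intro u
  have h : u ⬝ᵥ symplJ n *ᵥ u = -(u ⬝ᵥ symplJ n *ᵥ u) := by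
    conv_lhs => rw [dotProduct_mulVec, ← mulVec_transpose, symplJ_transpose, dotProduct_comm]
    simp [neg_mulVec]
  rw [Matrix.toBilin'_apply']
  linarith

/-- A skew-Hamiltonian matrix has a Hamiltonian square root. -/
theorem exists_hamiltonian_sqrt (n : ℕ) (W : Matrix (Fin n ⊕ Fin n) (Fin n ⊕ Fin n) ℝ)
    (hW : Wᵀ * symplJ n = symplJ n * W) :
    ∃ H : Matrix (Fin n ⊕ Fin n) (Fin n ⊕ Fin n) ℝ,
      H * H = W ∧ Hᵀ * symplJ n = -(symplJ n * H) := by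
  have hnd : (Matrix.toBilin' (symplJ n)).Nondegenerate :=
    (Matrix.nondegenerate_of_det_ne_zero (isUnit_det_symplJ n).ne_zero).toBilin'
  have hform (A B : Matrix (Fin n ⊕ Fin n) (Fin n ⊕ Fin n) ℝ) (u v : Fin n ⊕ Fin n → ℝ) :
      Matrix.toBilin' (symplJ n) (A *ᵥ u) (B *ᵥ v) =
        Matrix.toBilin' (Aᵀ * symplJ n * B) u v := by
    simp only [Matrix.toBilin'_apply', ← mulVec_mulVec]
    rw [dotProduct_mulVec u, vecMul_transpose]
  obtain ⟨H, hHH, hH⟩ := LinearMap.BilinForm.exists_skewAdjoint_sqrt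
    (isAlt_toBilin'_symplJ n) hnd (W := Matrix.toLin' W) (fun u v => by
      have h₁ := hform W 1 u v
      have h₂ := hform 1 W u v
      simp only [one_mulVec, transpose_one, mul_one, one_mul] at h₁ h₂
      rw [Matrix.toLin'_apply, Matrix.toLin'_apply, h₁, h₂, hW])
  obtain ⟨A, rfl⟩ := Matrix.toLin'.surjective H
  refine ⟨A, ?_, ?_⟩
  · apply Matrix.toLin'.injective
    refine LinearMap.ext fun v => ?_
    rw [Matrix.toLin'_mul_apply, hHH]
  · apply Matrix.toBilin'.injective
    refine LinearMap.ext₂ fun u v => ?_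
    have h₁ := hform A 1 u v
    have h₂ := hform 1 A u v
    simp only [one_mulVec, transpose_one, mul_one, one_mul] at h₁ h₂
    have h := hH u v
    rw [Matrix.toLin'_apply, Matrix.toLin'_apply, h₁, h₂] at h
    rw [h, map_neg]
    rfl

/-- Theorem 1: a nondegenerate `X` factors as `X = H * T` with `H` Hamiltonian and `T` anti-symplectic. -/
theorem stmt_1 (n : ℕ) (X : Matrix (Fin n ⊕ Fin n) (Fin n ⊕ Fin n) ℝ)
    (hX : X.det ≠ 0) :
    ∃ H T : Matrix (Fin n ⊕ Fin n) (Fin n ⊕ Fin n) ℝ,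
      (symplJ n * H)ᵀ = symplJ n * H ∧ T * symplJ n * Tᵀ = -(symplJ n) ∧ X = H * T := by
  set J := symplJ n
  have hJt : Jᵀ = -J := symplJ_transpose n
  have hJJ : J * J = -1 := symplJ_mul_self n
  obtain ⟨H, hHH, hH⟩ := exists_hamiltonian_sqrt n (-(X * J * Xᵀ * J)) (by
    change _ * J = J * _
    simp only [transpose_neg, transpose_mul, transpose_transpose, hJt]
    noncomm_ring)
  have hdet : IsUnit H.det := by
    have hJ : J.det ≠ 0 := (isUnit_det_symplJ n).ne_zero
    have h : (H * H).det ≠ 0 := by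
      rw [hHH, det_neg, det_mul, det_mul, det_mul, det_transpose]
      simp [hX, hJ]
    rw [det_mul] at h
    exact isUnit_iff_ne_zero.2 (left_ne_zero_of_mul h)
  have hJH : J * Hᵀ = -(H * J) := by
    calc J * Hᵀ = -(J * (Hᵀ * J) * J) := by
          rw [mul_assoc, mul_assoc, hJJ]
          simp
      _ = -(H * J) := by
          rw [hH, mul_neg, ← mul_assoc, hJJ]
          simp
  have hXJX : X * J * Xᵀ = H * -J * Hᵀ := by
    calc X * J * Xᵀ = H * H * J := by
          rw [hHH, neg_mul, mul_assoc _ J J, hJJ]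
          simp
      _ = H * -J * Hᵀ := by
          rw [mul_assoc H (-J), neg_mul, hJH, neg_neg, mul_assoc]
  refine ⟨H, H⁻¹ * X, ?_, ?_, ?_⟩
  · rw [transpose_mul, hJt, mul_neg, hH, neg_neg]
  · have hdet' : IsUnit Hᵀ.det := by rwa [det_transpose]
    calc H⁻¹ * X * J * (H⁻¹ * X)ᵀ = H⁻¹ * (X * J * Xᵀ) * Hᵀ⁻¹ := by
          rw [transpose_mul, transpose_nonsing_inv]
          simp only [mul_assoc]
      _ = -J := by
          rw [hXJX, mul_assoc H, nonsing_inv_mul_cancel_left _ _ hdet,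
            mul_nonsing_inv_cancel_right _ _ hdet']
  · rw [mul_nonsing_inv_cancel_left _ _ hdet]
end

section
/- Let X be a real 2n×2n matrix with det X ≠ 0. Then there exists a Hamiltonian matrix H (i.e. (J·H)ᵀ = J·H) and a real anti-symplectic matrix T (i.e. T·J·Tᵀ = -J) such that X = T·H. -/
open Matrix

open Polynomial in
/-- There are a vector `u` and a functional `φ` such that the form `(f, h) ↦ φ ((f * h)(W) u)` on
polynomials has left kernel contained in the annihilator of `W`. -/
theorem exists_vector_functional_detecting_aeval {K V : Type*} [Field K] [AddCommGroup V]
    [Module K V] [FiniteDimensional K V] (W : Module.End K V) :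
    ∃ (u : V) (φ : Module.Dual K V),
      ∀ f : K[X], (∀ h : K[X], φ (aeval W (f * h) u) = 0) → aeval W f = 0 := by
  obtain ⟨x, hx⟩ := Module.exists_ker_toSpanSingleton_eq_annihilator K[X] (Module.AEval' W)
  obtain ⟨u, rfl⟩ := (Module.AEval'.of W).surjective x
  rw [← span_minpoly_eq_annihilator] at hx
  have hmonic : (minpoly K W).Monic := minpoly.monic (Algebra.IsIntegral.isIntegral W)
  have hu (f : K[X]) : aeval W f u = 0 → minpoly K W ∣ f := by
    intro hf
    rw [← Ideal.mem_span_singleton, ← hx, LinearMap.mem_ker, LinearMap.toSpanSingleton_apply,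
      Module.AEval'.of, ← Module.AEval.of_aeval_smul]
    simpa using hf
  let a : K[X] →ₗ[K] V := (LinearMap.applyₗ u) ∘ₗ (aeval W).toLinearMap
  have hψ : (lcoeff K ((minpoly K W).natDegree - 1)) ∘ₗ modByMonicHom (minpoly K W) ∈
      LinearMap.range a.dualMap := by
    rw [LinearMap.range_dualMap_eq_dualAnnihilator_ker, Submodule.mem_dualAnnihilator]
    intro f hf
    have := (mem_ker_modByMonic hmonic).2 (hu f hf)
    rw [LinearMap.comp_apply, LinearMap.mem_ker.1 this, map_zero]
  obtain ⟨φ, hφ⟩ := hψ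
  refine ⟨u, φ, fun f hf => ?_⟩
  have hcoeff (h : K[X]) :
      ((f * h) %ₘ minpoly K W).coeff ((minpoly K W).natDegree - 1) = 0 :=
    (LinearMap.congr_fun hφ (f * h)).symm.trans (hf h)
  rw [← modByMonic_add_div f (minpoly K W), map_add, map_mul, minpoly.aeval, zero_mul, add_zero]
  suffices f %ₘ minpoly K W = 0 by rw [this, map_zero]
  by_contra hr
  set r := f %ₘ minpoly K W
  have hdeg : r.natDegree < (minpoly K W).natDegree :=
    natDegree_lt_natDegree hr (degree_modByMonic_lt f hmonic)
  set k := (minpoly K W).natDegree - 1 - r.natDegree with hk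
  have hmod : (f * X ^ k) %ₘ minpoly K W = r * X ^ k := by
    have hsmall : (r * X ^ k) %ₘ minpoly K W = r * X ^ k := by
      rw [modByMonic_eq_self_iff hmonic]
      refine degree_lt_degree ?_
      rw [natDegree_mul_X_pow _ hr]
      omega
    rw [← hsmall]
    refine modByMonic_eq_of_dvd_sub hmonic ?_
    rw [← sub_mul]
    exact Dvd.dvd.mul_right ⟨f /ₘ minpoly K W, by
      rw [sub_eq_iff_eq_add', modByMonic_add_div]⟩ _
  have := hcoeff (X ^ k)
  rw [hmod, show (minpoly K W).natDegree - 1 = r.natDegree + k by omega, coeff_mul_X_pow] at this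
  exact hr (leadingCoeff_eq_zero.1 this)

/-- An endomorphism self-adjoint for a nondegenerate alternating form has a square root that is
skew-adjoint for that form. -/
theorem exists_skewAdjoint_sqrt {K : Type*} [Field K] [NeZero (2 : K)] {V : Type*}
    [AddCommGroup V] [Module K V] [FiniteDimensional K V] (B : LinearMap.BilinForm K V)
    (hB : B.Nondegenerate) (halt : B.IsAlt) (W : Module.End K V)
    (hW : ∀ x y, B (W x) y = B x (W y)) :
    ∃ H : Module.End K V, H * H = W ∧ ∀ x y, B (H x) y = -B x (H y) := by
  induction hn : Module.finrank K V using Nat.strong_induction_on generalizing V with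
  | _ n ih =>
  subst hn
  rcases subsingleton_or_nontrivial V with hV | hV
  · exact ⟨0, Subsingleton.elim _ _, fun x y => by simp⟩
  obtain ⟨u, φ, hφ⟩ := exists_vector_functional_detecting_aeval W
  obtain ⟨v, rfl⟩ := (B.toDual hB).surjective φ
  simp only [LinearMap.BilinForm.toDual_def] at hφ
  have hrefl := halt.isRefl
  have hskew (x y : V) : B x y = -B y x := (LinearMap.BilinForm.IsAlt.neg_eq halt y x).symm
  have hadj (f : Polynomial K) (x y : V) :
      B (Polynomial.aeval W f x) y = B x (Polynomial.aeval W f y) := by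
    induction f using Polynomial.induction_on' generalizing x y with
    | add p q hp hq => simp [hp, hq]
    | monomial k c =>
      simp only [Polynomial.aeval_monomial, Module.End.mul_apply, Module.algebraMap_end_apply,
        map_smul, LinearMap.smul_apply]
      congr 1
      induction k generalizing x y with
      | zero => simp
      | succ k ihk => rw [pow_succ, Module.End.mul_apply, ihk, hW, ← Module.End.mul_apply,
          ← pow_succ', pow_succ]
  have hmulapp (f g : Polynomial K) (x : V) :
      Polynomial.aeval W f (Polynomial.aeval W g x) = Polynomial.aeval W (f * g) x := by
    rw [map_mul, Module.End.mul_apply]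
  have hiso (f g : Polynomial K) (x : V) :
      B (Polynomial.aeval W f x) (Polynomial.aeval W g x) = 0 := by
    rw [hadj, hmulapp]
    have h1 := hskew x (Polynomial.aeval W (f * g) x)
    rw [hadj, eq_neg_iff_add_eq_zero, ← two_mul] at h1
    exact (mul_eq_zero.1 h1).resolve_left (NeZero.ne 2)
  let P : (Polynomial K × Polynomial K) →ₗ[K] V :=
    ((LinearMap.applyₗ u) ∘ₗ (Polynomial.aeval W).toLinearMap).coprod
      ((LinearMap.applyₗ v) ∘ₗ (Polynomial.aeval W).toLinearMap)
  have hP (f g : Polynomial K) :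
      P (f, g) = Polynomial.aeval W f u + Polynomial.aeval W g v := rfl
  let N : Submodule K V := LinearMap.range P
  have hker (f g : Polynomial K) (h : ∀ z, B (P (f, g)) (P z) = 0) :
      Polynomial.aeval W f = 0 ∧ Polynomial.aeval W g = 0 := by
    constructor
    · refine hφ f fun p => ?_
      have := h (0, p)
      rw [hP, hP, map_zero, LinearMap.zero_apply, zero_add, map_add, LinearMap.add_apply, hiso _ _ v,
        add_zero] at this
      rw [mul_comm, ← hmulapp, ← hadj, hskew, this, neg_zero]
    · refine hφ g fun p => ?_
      have := h (p, 0)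
      rw [hP, hP, map_zero, LinearMap.zero_apply, add_zero, map_add, LinearMap.add_apply, hiso _ _ u,
        zero_add] at this
      rw [← hmulapp, ← hadj, this]
  have hdisj : Disjoint N (B.orthogonal N) := by
    rw [Submodule.disjoint_def]
    rintro _ ⟨⟨f, g⟩, rfl⟩ hx
    obtain ⟨h1, h2⟩ := hker f g fun z => hrefl _ _ (hx _ ⟨z, rfl⟩)
    rw [hP, h1, h2]
    simp
  have hcompl : IsCompl N (B.orthogonal N) :=
    (LinearMap.BilinForm.isCompl_orthogonal_iff_disjoint hrefl).2 hdisj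
  have hWP (f g : Polynomial K) : W (P (f, g)) = P (Polynomial.X * f, Polynomial.X * g) := by
    simp [hP]
  have hWN : ∀ x ∈ B.orthogonal N, W x ∈ B.orthogonal N := by
    rintro x hx _ ⟨⟨f, g⟩, rfl⟩
    have := hx _ ⟨(Polynomial.X * f, Polynomial.X * g), rfl⟩
    rw [← hWP] at this
    exact (hW _ _).symm.trans this
  have hNnondeg : (B.restrict (B.orthogonal N)).Nondegenerate := by
    refine B.nondegenerate_restrict_of_disjoint_orthogonal hrefl ?_
    rw [LinearMap.BilinForm.orthogonal_orthogonal hB hrefl]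
    exact hdisj.symm
  have hlt : Module.finrank K (B.orthogonal N) < Module.finrank K V := by
    refine Submodule.finrank_lt fun htop => ?_
    have hbot : N = ⊥ := by simpa [htop] using hdisj
    have h0 (z) : P z = 0 := by
      have : P z ∈ N := ⟨z, rfl⟩
      rwa [hbot, Submodule.mem_bot] at this
    have := (hker 1 0 fun z => by rw [h0 z, map_zero]).1
    rw [map_one] at this
    exact one_ne_zero this
  obtain ⟨H', hH', hH'skew⟩ := ih _ hlt (B.restrict (B.orthogonal N)) hNnondeg
    (fun x => halt x) (W.restrict hWN) (fun x y => hW x y) rfl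
  let L : ((Polynomial K × Polynomial K) × B.orthogonal N) →ₗ[K] V :=
    P.coprod (B.orthogonal N).subtype
  have hL (f g : Polynomial K) (y : B.orthogonal N) : L ((f, g), y) = P (f, g) + y := rfl
  have hLsurj : LinearMap.range L = ⊤ := by
    rw [LinearMap.range_coprod, Submodule.range_subtype]
    exact hcompl.sup_eq_top
  let M : Module.End K ((Polynomial K × Polynomial K) × B.orthogonal N) :=
    (((LinearMap.mulLeft K Polynomial.X ∘ₗ LinearMap.snd K _ _).prod
      (LinearMap.fst K _ _))).prodMap H'
  have hM (f g : Polynomial K) (y : B.orthogonal N) :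
      M ((f, g), y) = ((Polynomial.X * g, f), H' y) := rfl
  have hLM : ∀ z, L z = 0 → L (M z) = 0 := by
    rintro ⟨⟨f, g⟩, y⟩ hz
    have hy : P (f, g) = -(y : V) := eq_neg_of_add_eq_zero_left hz
    obtain ⟨h1, h2⟩ := hker f g fun z => by
      rw [hy, map_neg, LinearMap.neg_apply, hrefl _ _ (y.2 _ ⟨z, rfl⟩), neg_zero]
    have hy0 : y = 0 := by
      rw [hP, h1, h2] at hy
      simpa using hy
    rw [hM, hL, hP, map_mul, h1, h2, hy0]
    simp
  obtain ⟨s, hs⟩ := L.exists_rightInverse_of_surjective hLsurj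
  have hLs (x : V) : L (s x) = x := LinearMap.congr_fun hs x
  have hH (z) : (L ∘ₗ M ∘ₗ s) (L z) = L (M z) := by
    have := hLM (s (L z) - z) (by rw [map_sub, hLs, sub_self])
    rwa [map_sub, map_sub, sub_eq_zero] at this
  refine ⟨L ∘ₗ M ∘ₗ s, ?_, ?_⟩
  · ext x
    obtain ⟨⟨⟨f, g⟩, y⟩, rfl⟩ := LinearMap.range_eq_top.1 hLsurj x
    have hy : ((H' (H' y) : B.orthogonal N) : V) = W y :=
      congrArg Subtype.val (LinearMap.congr_fun hH' y)
    rw [Module.End.mul_apply, hH, hH, hM, hM, hL, hL, map_add, hWP, hy]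
  · intro x x'
    obtain ⟨⟨⟨f, g⟩, y⟩, rfl⟩ := LinearMap.range_eq_top.1 hLsurj x
    obtain ⟨⟨⟨f', g'⟩, y'⟩, rfl⟩ := LinearMap.range_eq_top.1 hLsurj x'
    have hy : B (H' y) y' = -B y (H' y') := hH'skew y y'
    have hNr (z) (y : B.orthogonal N) : B (P z) y = 0 := y.2 _ ⟨z, rfl⟩
    have hNl (z) (y : B.orthogonal N) : B y (P z) = 0 := hrefl _ _ (hNr z y)
    have huv (p q : Polynomial K) : B (Polynomial.aeval W p u) (Polynomial.aeval W q v) =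
        B u (Polynomial.aeval W (p * q) v) := by rw [hadj, hmulapp]
    have hvu (p q : Polynomial K) : B (Polynomial.aeval W p v) (Polynomial.aeval W q u) =
        -B u (Polynomial.aeval W (q * p) v) := by rw [hskew, huv]
    rw [hH, hH, hM, hM, hL, hL, hL, hL]
    simp only [map_add, LinearMap.add_apply, hNr, hNl, hy]
    simp only [hP, map_add, LinearMap.add_apply, hiso, huv, hvu]
    rw [show Polynomial.X * g * g' = Polynomial.X * g' * g by ring, mul_comm f' f]
    ring

/-- Corollary: a nondegenerate `X` factors as `X = T * H` with `H` Hamiltonian and `T` anti-symplectic. -/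
theorem stmt_3 (n : ℕ) (X : Matrix (Fin n ⊕ Fin n) (Fin n ⊕ Fin n) ℝ)
    (hX : X.det ≠ 0) :
    ∃ H T : Matrix (Fin n ⊕ Fin n) (Fin n ⊕ Fin n) ℝ,
      (symplJ n * H)ᵀ = symplJ n * H ∧ T * symplJ n * Tᵀ = -(symplJ n) ∧ X = T * H := by
  have hJ := symplJ_mul_self n
  have hJt := symplJ_transpose n
  obtain ⟨H, hHH, hH⟩ := exists_hamiltonian_sqrt n (-(symplJ n * (Xᵀ * symplJ n * X))) (by
    simp only [Matrix.transpose_neg, Matrix.transpose_mul, Matrix.transpose_transpose, hJt,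
      Matrix.neg_mul, Matrix.mul_neg, neg_neg]
    rw [Matrix.mul_assoc _ (symplJ n) (symplJ n), ← Matrix.mul_assoc (symplJ n) (symplJ n), hJ]
    simp [Matrix.mul_assoc])
  have hdetJ : (symplJ n).det ≠ 0 := (Matrix.isUnit_det_J (Fin n) ℝ).ne_zero
  have hdetH : IsUnit H.det := by
    have hd : (H * H).det ≠ 0 := by
      rw [hHH, ← Matrix.neg_mul]
      have hnJ : (-symplJ n).det ≠ 0 := by rwa [← hJt, Matrix.det_transpose]
      simp only [Matrix.det_mul, Matrix.det_transpose]
      exact mul_ne_zero hnJ (mul_ne_zero (mul_ne_zero hX hdetJ) hX)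
    rw [Matrix.det_mul] at hd
    exact (left_ne_zero_of_mul hd).isUnit
  have hsq : Xᵀ * symplJ n * X = symplJ n * (H * H) := by
    rw [hHH, Matrix.mul_neg, ← Matrix.mul_assoc, hJ]
    simp
  have hHt : H⁻¹ᵀ * Hᵀ = 1 := by
    rw [← Matrix.transpose_mul, Matrix.mul_nonsing_inv _ hdetH, Matrix.transpose_one]
  have hT : (X * H⁻¹)ᵀ * symplJ n * (X * H⁻¹) = -symplJ n := by
    calc (X * H⁻¹)ᵀ * symplJ n * (X * H⁻¹) = H⁻¹ᵀ * (Xᵀ * symplJ n * X) * H⁻¹ := by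
          simp only [Matrix.transpose_mul, Matrix.mul_assoc]
      _ = H⁻¹ᵀ * (symplJ n * H) * (H * H⁻¹) := by
          rw [hsq]
          simp only [Matrix.mul_assoc]
      _ = -(H⁻¹ᵀ * Hᵀ * symplJ n) := by
          rw [Matrix.mul_nonsing_inv _ hdetH, Matrix.mul_one, Matrix.mul_assoc, hH,
            Matrix.mul_neg, neg_neg]
      _ = -symplJ n := by rw [hHt, Matrix.one_mul]
  refine ⟨H, X * H⁻¹, ?_, ?_, ?_⟩
  · rw [Matrix.transpose_mul, hJt, Matrix.mul_neg, hH, neg_neg]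
  · set T := X * H⁻¹
    have h1 : (symplJ n * Tᵀ * symplJ n) * T = 1 := by
      rw [Matrix.mul_assoc, Matrix.mul_assoc, ← Matrix.mul_assoc Tᵀ, hT, Matrix.mul_neg, hJ,
        neg_neg]
    have h2 : T * symplJ n * Tᵀ * symplJ n = 1 := by
      simpa only [Matrix.mul_assoc] using mul_eq_one_comm.1 h1
    calc T * symplJ n * Tᵀ = -(T * symplJ n * Tᵀ * symplJ n * symplJ n) := by
          rw [Matrix.mul_assoc _ (symplJ n) (symplJ n), hJ]
          simp
      _ = -symplJ n := by rw [h2, Matrix.one_mul]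
  · rw [Matrix.mul_assoc, Matrix.nonsing_inv_mul _ hdetH, Matrix.mul_one]
end

section
/- Let X be a real 2n×2n matrix such that the matrix Y = -X·J·Xᵀ·J has no zero and no positive real eigenvalues (i.e. no real number t ≥ 0 lies in the spectrum of Y). Then there exists a real skew-symmetric matrix A (Aᵀ = -A) and a real symplectic matrix S (S·J·Sᵀ = J) such that X = A·D·S, where D is the block diagonal matrix D = [[Iₙ, 0], [0, -Iₙ]]. -/
open Matrix

open Polynomial in
theorem exists_dvd_sq_sub_X_mul {x y : ℝ[X]} (hxy : IsCoprime x y)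
    (hx : ∃ p : ℝ[X], x ∣ p ^ 2 - X) (hy : ∃ p : ℝ[X], y ∣ p ^ 2 - X) :
    ∃ p : ℝ[X], x * y ∣ p ^ 2 - X := by
  obtain ⟨p, c, hc⟩ := hx
  obtain ⟨r, d, hd⟩ := hy
  obtain ⟨a, b, hab⟩ := id hxy
  refine ⟨r * (a * x) + p * (b * y), hxy.mul_dvd ?_ ?_⟩
  · have hb : b * y = 1 - a * x := by linear_combination hab
    rw [hb]
    exact ⟨c + a * (r - p) * (2 * p + a * x * (r - p)), by linear_combination hc⟩
  · have ha : a * x = 1 - b * y := by linear_combination hab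
    rw [ha]
    exact ⟨d + b * (p - r) * (2 * r + b * y * (p - r)), by linear_combination hd⟩

open Polynomial in
/-- One Newton step towards a square root of `X`. -/
theorem exists_sq_dvd_sq_sub_X {m : ℝ[X]} (hm : IsCoprime X m)
    (h : ∃ p : ℝ[X], m ∣ p ^ 2 - X) : ∃ p : ℝ[X], m ^ 2 ∣ p ^ 2 - X := by
  obtain ⟨p, c, hc⟩ := h
  have hp : IsCoprime p m := by
    have h1 : IsCoprime (X + m * c) m := hm.add_mul_left_left c
    rw [← hc, add_sub_cancel] at h1
    exact (IsCoprime.pow_left_iff two_pos).1 h1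
  obtain ⟨u, v, huv⟩ := hp
  have hhalf : (2 : ℝ[X]) * C (1 / 2) = 1 := by
    rw [← map_ofNat C 2, ← C_mul]
    norm_num
  refine ⟨p - (p ^ 2 - X) * (C (1 / 2) * u), c * v + c ^ 2 * (C (1 / 2) * u) ^ 2, ?_⟩
  have hX : (X : ℝ[X]) = p ^ 2 - m * c := by linear_combination -hc
  rw [hX]
  linear_combination (-(m * c)) * huv - p * m * c * u * hhalf

open Polynomial in
theorem exists_pow_dvd_sq_sub_X {q : ℝ[X]} (hq : IsCoprime X q)
    (h : ∃ p : ℝ[X], q ∣ p ^ 2 - X) (k : ℕ) : ∃ p : ℝ[X], q ^ k ∣ p ^ 2 - X := by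
  have key : ∃ p : ℝ[X], q ^ 2 ^ k ∣ p ^ 2 - X := by
    induction k with
    | zero => simpa using h
    | succ k ih =>
      rw [pow_succ, pow_mul]
      exact exists_sq_dvd_sq_sub_X hq.pow_right ih
  obtain ⟨p, hp⟩ := key
  exact ⟨p, (pow_dvd_pow q Nat.lt_two_pow_self.le).trans hp⟩

open Polynomial in
theorem exists_irreducible_dvd_sq_sub_X {q : ℝ[X]} (hq : Irreducible q)
    (hroot : ∀ t ≤ 0, ¬ q.IsRoot t) : ∃ p : ℝ[X], q ∣ p ^ 2 - X := by
  obtain ⟨z, hz⟩ := IsAlgClosed.exists_aeval_eq_zero ℂ q (degree_pos_of_irreducible hq).ne'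
  suffices h : ∃ p : ℝ[X], (aeval z p) ^ 2 = z by
    obtain ⟨p, hp⟩ := h
    refine ⟨p, ?_⟩
    have h1 : minpoly ℝ z ∣ p ^ 2 - X := minpoly.dvd ℝ z (by simp [hp])
    rw [← minpoly.eq_of_irreducible hq hz] at h1
    exact (dvd_mul_right _ _).trans h1
  by_cases him : z.im = 0
  · have hzr : z = ((z.re : ℝ) : ℂ) := Complex.ext rfl (by simpa using him)
    have hpos : 0 < z.re := by
      by_contra! hle
      apply hroot z.re hle
      rw [hzr] at hz
      have := aeval_algebraMap_apply ℂ z.re q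
      simp only [Complex.coe_algebraMap] at this
      rw [this] at hz
      simpa using hz
    refine ⟨C (Real.sqrt z.re), ?_⟩
    rw [aeval_C, Complex.coe_algebraMap, ← Complex.ofReal_pow, Real.sq_sqrt hpos.le]
    exact hzr.symm
  · obtain ⟨w, hw⟩ := IsAlgClosed.exists_pow_nat_eq z two_pos
    refine ⟨C (w.re - w.im / z.im * z.re) + C (w.im / z.im) * X, ?_⟩
    rw [← hw]
    congr 1
    rw [hw]
    apply Complex.ext
    · simp
    · simp [him]

open Polynomial in
theorem exists_dvd_sq_sub_X {m : ℝ[X]} (hm : ∀ t ≤ 0, ¬ m.IsRoot t) :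
    ∃ p : ℝ[X], m ∣ p ^ 2 - X := by
  induction m using UniqueFactorizationMonoid.induction_on_coprime with
  | h0 => exact absurd (by simp) (hm 0 le_rfl)
  | h1 hx => exact ⟨0, hx.dvd⟩
  | hpr i hq =>
    rename_i q
    rcases Nat.eq_zero_or_pos i with rfl | hi
    · exact ⟨0, by simp⟩
    have hroot : ∀ t ≤ 0, ¬ q.IsRoot t := fun t ht h =>
      hm t ht (h.dvd (dvd_pow_self q hi.ne'))
    refine exists_pow_dvd_sq_sub_X ?_ (exists_irreducible_dvd_sq_sub_X hq.irreducible hroot) i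
    refine ((hq.irreducible.coprime_iff_not_dvd).2 fun hdvd => ?_).symm
    have hX : X ∣ q := (hq.irreducible.associated_of_dvd irreducible_X hdvd).symm.dvd
    exact hroot 0 le_rfl (IsRoot.dvd (by simp) hX)
  | hcp hrel hx hy =>
    exact exists_dvd_sq_sub_X_mul hrel.isCoprime
      (hx fun t ht h => hm t ht (h.dvd (dvd_mul_right _ _)))
      (hy fun t ht h => hm t ht (h.dvd (dvd_mul_left _ _)))

/-- A real matrix without nonpositive real eigenvalues has a square root that is a polynomial
in it. -/
theorem Matrix.exists_aeval_sq_eq {ι : Type*} [Fintype ι] [DecidableEq ι] (Z : Matrix ι ι ℝ)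
    (hZ : ∀ t ≤ 0, t ∉ spectrum ℝ Z) :
    ∃ p : Polynomial ℝ, Polynomial.aeval Z p ^ 2 = Z := by
  obtain ⟨p, c, hc⟩ := exists_dvd_sq_sub_X (m := Z.charpoly) fun t ht h =>
    hZ t ht (Matrix.mem_spectrum_iff_isRoot_charpoly.2 h)
  refine ⟨p, ?_⟩
  have h := congrArg (Polynomial.aeval Z) hc
  simpa [Matrix.aeval_self_charpoly, sub_eq_zero] using h

theorem Matrix.mul_transpose_aeval_eq {ι : Type*} [Fintype ι] [DecidableEq ι]
    {J Z : Matrix ι ι ℝ} (h : J * Zᵀ = Z * J) (p : Polynomial ℝ) :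
    J * (Polynomial.aeval Z p)ᵀ = Polynomial.aeval Z p * J := by
  have hpow (k : ℕ) : J * Zᵀ ^ k = Z ^ k * J :=
    (SemiconjBy.pow_right (a := J) (x := Zᵀ) (y := Z) h k)
  induction p using Polynomial.induction_on' with
  | add p q hp hq => simp [mul_add, add_mul, hp, hq]
  | monomial k a =>
    simp [Polynomial.aeval_monomial, Matrix.transpose_pow, Algebra.algebraMap_eq_smul_one, hpow]

theorem Dmat_transpose (n : ℕ) : (Dmat n)ᵀ = Dmat n := by
  simp [Dmat, Matrix.fromBlocks_transpose]

theorem Dmat_mul_self (n : ℕ) : Dmat n * Dmat n = 1 := by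
  simp [Dmat, Matrix.fromBlocks_multiply]

theorem Dmat_mul_symplJ_mul_Dmat (n : ℕ) : Dmat n * symplJ n * Dmat n = -symplJ n := by
  simp [Dmat, symplJ, Matrix.fromBlocks_multiply, Matrix.fromBlocks_neg]

/-- Corollary: if `Y = -X*J*X^T*J` has no real eigenvalue `t ≥ 0`, then `X = A * D * S` with `A` skew-symmetric and `S` symplectic. -/
theorem stmt_8 (n : ℕ) (X : Matrix (Fin n ⊕ Fin n) (Fin n ⊕ Fin n) ℝ)
    (hY : ∀ t : ℝ, t ≥ 0 → t ∉ spectrum ℝ (-(X * symplJ n * Xᵀ * symplJ n))) :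
    ∃ A S : Matrix (Fin n ⊕ Fin n) (Fin n ⊕ Fin n) ℝ,
      Aᵀ = -A ∧ S * symplJ n * Sᵀ = symplJ n ∧ X = A * Dmat n * S := by
  have hJJ := symplJ_mul_self n
  have hJT := symplJ_transpose n
  have hDT := Dmat_transpose n
  have hDD := Dmat_mul_self n
  have hDJD := Dmat_mul_symplJ_mul_Dmat n
  set J := symplJ n
  set D := Dmat n
  obtain ⟨Z, hZ⟩ : ∃ Z, Z = X * J * Xᵀ * J := ⟨_, rfl⟩
  rw [← hZ] at hY
  have hspec : ∀ t ≤ 0, t ∉ spectrum ℝ Z := fun t ht h =>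
    hY (-t) (neg_nonneg.2 ht) (by rw [← spectrum.neg_eq]; simpa using h)
  have hZJ : Z * J = -(X * J * Xᵀ) := by
    rw [hZ, mul_assoc _ J J, hJJ, mul_neg, mul_one]
  have hJZ : J * Zᵀ = Z * J := by
    rw [hZJ, hZ]
    simp only [transpose_mul, transpose_transpose, hJT, neg_mul, mul_neg, neg_neg]
    rw [← mul_assoc J J, hJJ]
    simp [mul_assoc]
  obtain ⟨p, hp⟩ := Matrix.exists_aeval_sq_eq Z hspec
  have hJR := Matrix.mul_transpose_aeval_eq hJZ p
  set R := Polynomial.aeval Z p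
  obtain ⟨A, hA⟩ : ∃ A, A = -(R * J) := ⟨_, rfl⟩
  have hAT : Aᵀ = -A := by
    rw [hA, transpose_neg, transpose_mul, hJT, neg_mul, hJR]
  have hAJA : A * J * A = X * J * Xᵀ := by
    have h1 : A * J = R := by rw [hA, neg_mul, mul_assoc, hJJ, mul_neg, mul_one, neg_neg]
    rw [h1, hA, mul_neg, ← mul_assoc, ← sq, hp, hZJ, neg_neg]
  have hZu : IsUnit Z := spectrum.zero_notMem_iff ℝ |>.1 (hspec 0 le_rfl)
  have hRu : IsUnit R := (isUnit_pow_iff two_ne_zero).1 (hp ▸ hZu)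
  have hJu : IsUnit J := IsUnit.of_mul_eq_one (-J) (by rw [mul_neg, hJJ, neg_neg])
  have hAu : IsUnit A := hA ▸ (hRu.mul hJu).neg
  have hdet := (Matrix.isUnit_iff_isUnit_det A).1 hAu
  have hAi := Matrix.mul_nonsing_inv A hdet
  have hiA := Matrix.nonsing_inv_mul A hdet
  have hiT : (A⁻¹)ᵀ = -A⁻¹ := by
    rw [transpose_nonsing_inv, hAT]
    exact Matrix.inv_eq_right_inv (by rw [neg_mul_neg, hAi])
  refine ⟨A, D * A⁻¹ * X, hAT, ?_, ?_⟩
  · calc D * A⁻¹ * X * J * (D * A⁻¹ * X)ᵀ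
        = -(D * A⁻¹ * (X * J * Xᵀ) * A⁻¹ * D) := by
          simp only [transpose_mul, hiT, hDT, mul_assoc, neg_mul, mul_neg]
      _ = -(D * (A⁻¹ * A) * J * (A * A⁻¹) * D) := by
          rw [← hAJA]
          simp only [mul_assoc]
      _ = J := by rw [hAi, hiA, mul_one, mul_one, hDJD, neg_neg]
  · calc X = A * (D * D) * A⁻¹ * X := by rw [hDD, mul_one, hAi, one_mul]
      _ = A * D * (D * A⁻¹ * X) := by simp only [mul_assoc]
end

section
/- Let (K₁, l₁, α₁) and (K₂, l₂, α₂) be bosonic Gaussian channels, i.e. triples of real 2n×2n matrices K, α and a vector l in ℝ^{2n} with α symmetric such that the complex matrix α - (i/2)(J - Kᵀ·J·K) is positive semidefinite (where the real matrices are viewed as complex matrices). Then their product (K₁·K₂, K₂ᵀ·l₁ + l₂, K₂ᵀ·α₁·K₂ + α₂) is again a bosonic Gaussian channel: K₂ᵀ·α₁·K₂ + α₂ is symmetric and the complex matrix (K₂ᵀ·α₁·K₂ + α₂) - (i/2)(J - (K₁·K₂)ᵀ·J·(K₁·K₂)) is positive semidefinite. -/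
open Matrix
open scoped ComplexOrder

/-- The triple `(K, l, α)` is a bosonic Gaussian channel: `α` is symmetric and the complex
matrix `α - (i/2)(J - Kᵀ·J·K)` is positive semidefinite. -/
def IsBosonicGaussianChannel (n : ℕ) (K : Matrix (Fin n ⊕ Fin n) (Fin n ⊕ Fin n) ℝ)
    (l : (Fin n ⊕ Fin n) → ℝ) (α : Matrix (Fin n ⊕ Fin n) (Fin n ⊕ Fin n) ℝ) : Prop :=
  αᵀ = α ∧
    (α.map (Complex.ofReal) -
      (Complex.I / 2) • ((symplJ n).map Complex.ofReal -
        (Kᵀ * symplJ n * K).map Complex.ofReal)).PosSemidef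

/-- The product of two bosonic Gaussian channels,
`(K₂, l₂, α₂)(K₁, l₁, α₁) = (K₁·K₂, K₂ᵀ·l₁ + l₂, K₂ᵀ·α₁·K₂ + α₂)`,
is again a bosonic Gaussian channel. -/
theorem stmt_13 (n : ℕ)
    (K₁ K₂ α₁ α₂ : Matrix (Fin n ⊕ Fin n) (Fin n ⊕ Fin n) ℝ)
    (l₁ l₂ : (Fin n ⊕ Fin n) → ℝ)
    (h₁ : IsBosonicGaussianChannel n K₁ l₁ α₁)
    (h₂ : IsBosonicGaussianChannel n K₂ l₂ α₂) :
    IsBosonicGaussianChannel n (K₁ * K₂) (K₂ᵀ *ᵥ l₁ + l₂) (K₂ᵀ * α₁ * K₂ + α₂) := by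
  obtain ⟨hs₁, hp₁⟩ := h₁
  obtain ⟨hs₂, hp₂⟩ := h₂
  refine ⟨by simp [Matrix.transpose_mul, hs₁, hs₂, Matrix.mul_assoc], ?_⟩
  have hmul (A B : Matrix (Fin n ⊕ Fin n) (Fin n ⊕ Fin n) ℝ) :
      (A * B).map Complex.ofReal = A.map Complex.ofReal * B.map Complex.ofReal :=
    Matrix.map_mul (f := Complex.ofRealHom)
  have hadd (A B : Matrix (Fin n ⊕ Fin n) (Fin n ⊕ Fin n) ℝ) :
      (A + B).map Complex.ofReal = A.map Complex.ofReal + B.map Complex.ofReal :=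
    Matrix.map_add _ Complex.ofReal_add A B
  have hK : (K₂.map Complex.ofReal)ᴴ = K₂ᵀ.map Complex.ofReal := by
    ext i j
    simp
  have h := (hp₁.conjTranspose_mul_mul_same (K₂.map Complex.ofReal)).add hp₂
  convert h using 1
  simp only [hK, hmul, hadd, Matrix.transpose_mul, Matrix.mul_sub, Matrix.sub_mul,
    Matrix.mul_smul, Matrix.smul_mul, smul_sub, Matrix.mul_assoc]
  abel
end
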